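/- arXiv:2404.08370 — 2 statements merged into one kernel-verified Lean document; each statement's English description precedes it below -/
import Mathlib

section
/- Let n ≥ 3 and let Av = b be a linear system over 𝔽₂ in the variables of DLO_n with at most n−3 equations that has a WORDER_n-proper solution σ with σ(z_{ikj}) = 0 for all distinct i,k,j. Then for every density clause D_{st} there exists a WORDER_n-proper solution τ of Av = b that satisfies D_{st} and such that τ(z_{ikj}) = 1 only if i = s and j = t. -/
open Finset

/-- The two-element field. -/
abbrev F2 : Type := ZMod 2

/-- An `F2`-linear form in the variables `V`, given by its coefficients. -/
abbrev LinForm (V : Type) : Type := V → F2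

/-- A linear literal: an equation `f = a` where `f` is a linear form and `a ∈ F2`. -/
abbrev LinLit (V : Type) : Type := LinForm V × F2

/-- A linear clause: a finite disjunction of linear literals. -/
abbrev LinClause (V : Type) : Type := Finset (LinLit V)

/-- A linear system: a finite conjunction of linear equations. -/
abbrev LinSystem (V : Type) : Type := Finset (LinLit V)

/-- A linear CNF formula: a conjunction of linear clauses. -/
abbrev LinCNF (V : Type) : Type := Set (LinClause V)

variable {V : Type}

/-- Evaluation of a linear form at an assignment. -/
def evalForm [Fintype V] (f : LinForm V) (σ : V → F2) : F2 := ∑ v, f v * σ v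

/-- The assignment `σ` satisfies the linear equation `l.1 = l.2`. -/
def LitSat [Fintype V] (σ : V → F2) (l : LinLit V) : Prop := evalForm l.1 σ = l.2

/-- The assignment `σ` satisfies the linear clause `C` (some literal of `C` holds). -/
def ClauseSat [Fintype V] (σ : V → F2) (C : LinClause V) : Prop := ∃ l ∈ C, LitSat σ l

/-- The assignment `σ` is a solution of the linear system `S` (all equations hold). -/
def SysSat [Fintype V] (σ : V → F2) (S : LinSystem V) : Prop := ∀ l ∈ S, LitSat σ l

/-- The assignment `σ` satisfies the linear CNF `φ`. -/
def CNFSat [Fintype V] (σ : V → F2) (φ : LinCNF V) : Prop := ∀ C ∈ φ, ClauseSat σ C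

/-- The linear CNF `φ` is unsatisfiable. -/
def Unsat [Fintype V] (φ : LinCNF V) : Prop := ¬ ∃ σ, CNFSat σ φ

/-- The positive literal `v = 1` for a single variable `v`. -/
def posLit [DecidableEq V] (v : V) : LinLit V := (Pi.single v 1, 1)

/-- The negative literal `v = 0` for a single variable `v`. -/
def negLit [DecidableEq V] (v : V) : LinLit V := (Pi.single v 1, 0)

/-- A solution is `F`-proper if it satisfies every clause of `F`. -/
def FProper [Fintype V] (F : Set (LinClause V)) (σ : V → F2) : Prop := ∀ C ∈ F, ClauseSat σ C

/-- `φ` is `m`-extensible w.r.t. `F`: every linear system with fewer than `m` equations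
that has an `F`-proper solution has, for each clause `C ∈ φ \ F`, an `F`-proper solution
satisfying `C`. -/
def Extensible [Fintype V] (φ : LinCNF V) (F : Set (LinClause V)) (m : ℕ) : Prop :=
  ∀ S : LinSystem V, S.card < m → (∃ σ, SysSat σ S ∧ FProper F σ) →
    ∀ C ∈ φ \ F, ∃ τ, SysSat τ S ∧ FProper F τ ∧ ClauseSat τ C

/-- The variables of `DLO_n`: order variables `x_{ij}` and witness variables `z_{ikj}`. -/
abbrev DLOVar (n : ℕ) : Type := (Fin n × Fin n) ⊕ (Fin n × Fin n × Fin n)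

/-- The order variable `x_{ij}`. -/
def xvar {n : ℕ} (i j : Fin n) : DLOVar n := Sum.inl (i, j)

/-- The witness variable `z_{ikj}`. -/
def zvar {n : ℕ} (i k j : Fin n) : DLOVar n := Sum.inr (i, k, j)

/-- An assignment is WORDER-proper if it satisfies every antisymmetry, totality,
transitivity, and witness-semantics clause of `DLO_n`. -/
def WOrderProper {n : ℕ} (σ : DLOVar n → F2) : Prop :=
  (∀ i j : Fin n, i ≠ j → ¬(σ (xvar i j) = 1 ∧ σ (xvar j i) = 1)) ∧
  (∀ i j : Fin n, i ≠ j → σ (xvar i j) = 1 ∨ σ (xvar j i) = 1) ∧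
  (∀ i j k : Fin n, i ≠ j → j ≠ k → i ≠ k →
    σ (xvar i j) = 1 → σ (xvar j k) = 1 → σ (xvar i k) = 1) ∧
  (∀ i k j : Fin n, i ≠ k → k ≠ j → i ≠ j →
    σ (zvar i k j) = 1 → σ (xvar i k) = 1 ∧ σ (xvar k j) = 1)

/-- The assignment `σ` satisfies the density clause
`D_{st} = ¬x_{st} ∨ ⋁_{k ≠ s,t} z_{skt}`. -/
def DensitySat {n : ℕ} (s t : Fin n) (σ : DLOVar n → F2) : Prop :=
  σ (xvar s t) = 0 ∨ ∃ k : Fin n, k ≠ s ∧ k ≠ t ∧ σ (zvar s k t) = 1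

lemma F2.eq_zero_or_one (a : F2) : a = 0 ∨ a = 1 := by
  revert a; decide

/-- The linear order encoded by a proper assignment is induced by an injective rank function. -/
lemma WOrderProper.exists_rank {n : ℕ} {σ : DLOVar n → F2} (h : WOrderProper σ) :
    ∃ r : Fin n → ℕ, (∀ i, r i < n) ∧ Function.Injective r ∧
      ∀ i j, i ≠ j → (σ (xvar i j) = 1 ↔ r i < r j) := by
  obtain ⟨hanti, htot, htrans, -⟩ := h
  let below : Fin n → Finset (Fin n) := fun i => univ.filter fun j => j ≠ i ∧ σ (xvar j i) = 1
  have hmono : ∀ i j, i ≠ j → σ (xvar i j) = 1 → (below i).card < (below j).card := by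
    intro i j hij hx
    apply Finset.card_lt_card
    refine (Finset.ssubset_iff_of_subset ?_).2 ⟨i, ?_, ?_⟩
    · intro k hk
      simp only [below, mem_filter, mem_univ, true_and] at hk ⊢
      have hkj : k ≠ j := by
        rintro rfl
        exact hanti i k hij ⟨hx, hk.2⟩
      exact ⟨hkj, htrans k i j hk.1 hij hkj hk.2 hx⟩
    · simp [below, hij, hx]
    · simp [below]
  refine ⟨fun i => (below i).card, fun i => ?_, fun i j hij => ?_, fun i j hij => ⟨hmono i j hij, ?_⟩⟩
  · have : below i ⊂ univ := by
      refine (Finset.ssubset_univ_iff).2 fun he => ?_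
      have : i ∈ below i := he ▸ mem_univ i
      simp [below] at this
    simpa using Finset.card_lt_card this
  · by_contra hne
    dsimp only at hij
    rcases htot i j hne with hx | hx
    · exact (hmono i j hne hx).ne hij
    · exact (hmono j i (Ne.symm hne) hx).ne hij.symm
  · intro hlt
    rcases htot i j hij with hx | hx
    · exact hx
    · exact absurd (hmono j i hij.symm hx) (not_lt.2 hlt.le)

/-- An assignment whose order variables are induced by an injective rank function, and whose
witness variables obey the witness semantics, is proper. -/
lemma WOrderProper.of_rank {n : ℕ} {τ : DLOVar n → F2} (R : Fin n → ℤ)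
    (hR : ∀ i j, i ≠ j → R i ≠ R j) (hx : ∀ i j, i ≠ j → (τ (xvar i j) = 1 ↔ R i < R j))
    (hz : ∀ i k j, i ≠ k → k ≠ j → i ≠ j → τ (zvar i k j) = 1 → R i < R k ∧ R k < R j) :
    WOrderProper τ := by
  refine ⟨fun i j hij => ?_, fun i j hij => ?_, fun i j k hij hjk hik => ?_,
    fun i k j hik hkj hij h => ?_⟩
  · rw [hx i j hij, hx j i hij.symm]
    omega
  · rw [hx i j hij, hx j i hij.symm]
    have := hR i j hij
    omega
  · rw [hx i j hij, hx j k hjk, hx i k hik]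
    omega
  · rw [hx i k hik, hx k j hkj]
    exact hz i k j hik hkj hij h

/-- Indicator of the elements `a` which `k` has to jump over in order to enter, from outside,
the interval between `s` and `t` of the order with rank `r`. -/
def jump {n : ℕ} (r : Fin n → ℕ) (s t k a : Fin n) : F2 :=
  if (r k < r a ∧ r a ≤ r s) ∨ (r t ≤ r a ∧ r a < r k) then 1 else 0

/-- The change of assignment that moves the elements selected by `c` between `s` and `t`,
and makes them witnesses for the pair `(s, t)`. -/
def shift {n : ℕ} (r : Fin n → ℕ) (s t : Fin n) : (Fin n → F2) →ₗ[F2] (DLOVar n → F2) where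
  toFun c
    | Sum.inl (i, j) => c i * jump r s t i j + c j * jump r s t j i
    | Sum.inr (i, k, j) => if i = s ∧ j = t then c k else 0
  map_add' c d := by
    ext v
    rcases v with ⟨i, j⟩ | ⟨i, k, j⟩
    · simp only [Pi.add_apply]
      ring
    · by_cases h : i = s ∧ j = t <;> simp [h]
  map_smul' a c := by
    ext v
    rcases v with ⟨i, j⟩ | ⟨i, k, j⟩
    · simp only [Pi.smul_apply, smul_eq_mul, RingHom.id_apply]
      ring
    · by_cases h : i = s ∧ j = t <;> simp [h]

/-- The rank function of the order obtained by moving the elements selected by `c`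
between `s` and `t`. -/
def shiftRank {n : ℕ} (r : Fin n → ℕ) (s t : Fin n) (c : Fin n → F2) (i : Fin n) : ℤ :=
  if r i < r s ∧ c i = 1 then 2 * r s - r i
  else if r i ≤ r s then r i
  else if r i < r t then r i + 2 * n
  else if r t < r i ∧ c i = 1 then 4 * n + 2 * r t - r i
  else 4 * n + r i

/-- Evaluation of linear forms is linear in the assignment. -/
def evalLinear {V : Type} [Fintype V] (f : LinForm V) : (V → F2) →ₗ[F2] F2 where
  toFun σ := evalForm f σ
  map_add' σ τ := by simp [evalForm, mul_add, Finset.sum_add_distrib]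
  map_smul' a σ := by simp [evalForm, Finset.mul_sum, mul_left_comm]

/-- A family of assignments depending linearly on `n` parameters has a nonzero member solving
at most `n - 3` homogeneous equations, with two prescribed parameters equal to zero. -/
lemma exists_ne_zero_evalForm_eq_zero {n : ℕ} (hn : 3 ≤ n) {V : Type} [Fintype V]
    (S : LinSystem V) (hcard : S.card ≤ n - 3) (D : (Fin n → F2) →ₗ[F2] (V → F2))
    (s t : Fin n) :
    ∃ c : Fin n → F2, c ≠ 0 ∧ c s = 0 ∧ c t = 0 ∧ ∀ l ∈ S, evalForm l.1 (D c) = 0 := by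
  let L : (Fin n → F2) →ₗ[F2] (S → F2) × F2 × F2 :=
    (LinearMap.pi fun l : S => evalLinear l.1.1 ∘ₗ D).prod
      ((LinearMap.proj s).prod (LinearMap.proj t))
  have hker : LinearMap.ker L ≠ ⊥ := by
    apply LinearMap.ker_ne_bot_of_finrank_lt
    simp only [Module.finrank_prod, Module.finrank_fintype_fun_eq_card, Fintype.card_coe,
      Module.finrank_self, Fintype.card_fin]
    omega
  obtain ⟨c, hc, hne⟩ := Submodule.exists_mem_ne_zero_of_ne_bot hker
  rw [LinearMap.mem_ker, Prod.ext_iff, Prod.ext_iff] at hc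
  exact ⟨c, hne, hc.2.1, hc.2.2, fun l hl => congrFun hc.1 ⟨l, hl⟩⟩

set_option maxHeartbeats 2000000 in
lemma add_shift_xvar_eq_one_iff {n : ℕ} {r : Fin n → ℕ} (hr : Function.Injective r)
    (hrn : ∀ i, r i < n) {s t : Fin n} (hst : r s < r t) {σ : DLOVar n → F2}
    {i j : Fin n} (hij : i ≠ j) (hx : σ (xvar i j) = 1 ↔ r i < r j) {c : Fin n → F2}
    (hs : c s = 0) (ht : c t = 0) :
    (σ + shift r s t c) (xvar i j) = 1 ↔ shiftRank r s t c i < shiftRank r s t c j := by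
  have hne : r i ≠ r j := hr.ne hij
  have hi := hrn i
  have hj := hrn j
  have his : c i = 1 → r i ≠ r s := fun h e => by simp [hr e, hs] at h
  have hit : c i = 1 → r i ≠ r t := fun h e => by simp [hr e, ht] at h
  have hjs : c j = 1 → r j ≠ r s := fun h e => by simp [hr e, hs] at h
  have hjt : c j = 1 → r j ≠ r t := fun h e => by simp [hr e, ht] at h
  have hσ : σ (xvar i j) = if r i < r j then 1 else 0 := by
    rcases F2.eq_zero_or_one (σ (xvar i j)) with h | h <;> simp_all
  change σ (xvar i j) + (c i * jump r s t i j + c j * jump r s t j i) = 1 ↔ _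
  rw [hσ]
  unfold jump shiftRank
  have h11 : (1 : F2) + 1 = 0 := by decide
  rcases F2.eq_zero_or_one (c i) with hci | hci <;>
    rcases F2.eq_zero_or_one (c j) with hcj | hcj <;>
    simp only [hci, hcj, zero_ne_one, and_false, and_true, if_false, zero_mul, one_mul, add_zero,
      zero_add, true_implies] at * <;>
    split_ifs <;> simp only [h11, add_zero, zero_add, zero_ne_one, true_iff, false_iff] <;> omega

/-- Let `n ≥ 3` and `Av = b` a linear system in the variables of `DLO_n`
with at most `n-3` equations having a WORDER-proper solution setting all `z`-variables to
`0`. Then for every density clause `D_{st}` there is a WORDER-proper solution `τ` of the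
system satisfying `D_{st}` with `τ(z_{ikj}) = 1` only if `i = s` and `j = t`. -/
theorem dlo_extension_helper (n : ℕ) (hn : 3 ≤ n)
    (S : LinSystem (DLOVar n)) (hcard : S.card ≤ n - 3)
    (σ : DLOVar n → F2) (hσ : SysSat σ S) (hprop : WOrderProper σ)
    (hz : ∀ i k j : Fin n, i ≠ k → k ≠ j → i ≠ j → σ (zvar i k j) = 0)
    (s t : Fin n) (hst : s ≠ t) :
    ∃ τ, SysSat τ S ∧ WOrderProper τ ∧ DensitySat s t τ ∧
      ∀ i k j : Fin n, i ≠ k → k ≠ j → i ≠ j → τ (zvar i k j) = 1 → i = s ∧ j = t := by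
  obtain ⟨r, hrn, hr, hx⟩ := hprop.exists_rank
  rcases F2.eq_zero_or_one (σ (xvar s t)) with h0 | h1
  · refine ⟨σ, hσ, hprop, Or.inl h0, fun i k j hik hkj hij h => ?_⟩
    simp [hz i k j hik hkj hij] at h
  have hlt : r s < r t := (hx s t hst).1 h1
  obtain ⟨c, hne, hs, ht, hc⟩ := exists_ne_zero_evalForm_eq_zero hn S hcard (shift r s t) s t
  have hzval : ∀ i k j, i ≠ k → k ≠ j → i ≠ j →
      (σ + shift r s t c) (zvar i k j) = if i = s ∧ j = t then c k else 0 := by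
    intro i k j hik hkj hij
    rw [Pi.add_apply, hz i k j hik hkj hij, zero_add]
    rfl
  have hxval := fun i j (hij : i ≠ j) =>
    add_shift_xvar_eq_one_iff hr hrn hlt hij (hx i j hij) hs ht
  refine ⟨σ + shift r s t c, fun l hl => ?_, WOrderProper.of_rank (shiftRank r s t c) ?_ hxval ?_,
    Or.inr ?_, fun i k j hik hkj hij h => ?_⟩
  · change evalLinear l.1 (σ + shift r s t c) = l.2
    rw [map_add]
    change evalForm l.1 σ + evalForm l.1 (shift r s t c) = l.2
    rw [hc l hl, add_zero]
    exact hσ l hl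
  · intro i j hij
    have hne : r i ≠ r j := hr.ne hij
    have hi := hrn i
    have hj := hrn j
    unfold shiftRank
    split_ifs <;> omega
  · intro i k j hik hkj hij h
    rw [hzval i k j hik hkj hij] at h
    split_ifs at h with he
    · obtain ⟨rfl, rfl⟩ := he
      have := hr.ne hik
      have := hr.ne hkj
      have := hrn k
      have := hrn j
      simp only [shiftRank, h, ht, zero_ne_one, and_true, and_false, if_false]
      constructor <;> split_ifs <;> omega
    · simp at h
  · obtain ⟨k, hk⟩ := Function.ne_iff.1 hne
    have hks : k ≠ s := by
      rintro rfl
      exact hk hs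
    have hkt : k ≠ t := by
      rintro rfl
      exact hk ht
    refine ⟨k, hks, hkt, ?_⟩
    rw [hzval s k t hks.symm hkt hst, if_pos ⟨rfl, rfl⟩]
    exact (F2.eq_zero_or_one (c k)).resolve_left hk
  · by_contra he
    simp [hzval i k j hik hkj hij, he] at h
end

section
/- For all n ≥ 3: every tree-like Res(⊕) refutation of DLO_n has size at least 2^{⌊(n−3)/3⌋}, and Space(DLO_n) ≥ ⌊(n−3)/3⌋. -/
open Finset

variable {V : Type}

/-- A binary proof tree whose nodes are labeled with linear clauses. -/
inductive ProofTree (V : Type) : Type where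
  | leaf (C : LinClause V) : ProofTree V
  | weak (C : LinClause V) (t : ProofTree V) : ProofTree V
  | res (C : LinClause V) (t₁ t₂ : ProofTree V) : ProofTree V

/-- The clause at the root of a proof tree. -/
def ProofTree.concl : ProofTree V → LinClause V
  | .leaf C => C
  | .weak C _ => C
  | .res C _ _ => C

/-- The size of a proof tree: its number of nodes. -/
def ProofTree.size : ProofTree V → ℕ
  | .leaf _ => 1
  | .weak _ t => t.size + 1
  | .res _ t₁ t₂ => t₁.size + t₂.size + 1

/-- A proof tree is valid w.r.t. `φ` if leaves are labeled by clauses of `φ` and each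
internal node is obtained from its children by the semantic weakening rule or the
resolution rule of Res(⊕). -/
def ProofTree.Valid [Fintype V] [DecidableEq V] (φ : LinCNF V) : ProofTree V → Prop
  | .leaf C => C ∈ φ
  | .weak C t => t.Valid φ ∧ ∀ σ, ClauseSat σ t.concl → ClauseSat σ C
  | .res C t₁ t₂ => t₁.Valid φ ∧ t₂.Valid φ ∧
      ∃ (f : LinForm V) (A B : LinClause V),
        t₁.concl = insert (f, (0 : F2)) A ∧ t₂.concl = insert (f, (1 : F2)) B ∧ C = A ∪ B

/-- A tree-like Res(⊕) refutation of `φ`: a valid proof tree deriving the empty clause. -/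
def IsTreeRefutation [Fintype V] [DecidableEq V] (φ : LinCNF V) (T : ProofTree V) : Prop :=
  T.Valid φ ∧ T.concl = ∅

/-- A configuration: a finite set of linear clauses kept in memory. -/
abbrev Config (V : Type) : Type := Finset (LinClause V)

/-- Semantic inference: `C` follows from clauses in `S` by the resolution rule or the
semantic weakening rule. -/
def InferSem [Fintype V] [DecidableEq V] (S : Config V) (C : LinClause V) : Prop :=
  (∃ (f : LinForm V) (A B : LinClause V),
      insert (f, (0 : F2)) A ∈ S ∧ insert (f, (1 : F2)) B ∈ S ∧ C = A ∪ B) ∨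
  (∃ D ∈ S, ∀ σ, ClauseSat σ D → ClauseSat σ C)

/-- The identically zero linear form. -/
def zeroForm (V : Type) : LinForm V := fun _ => 0

/-- Syntactic inference: `C` follows from clauses in `S` by the resolution rule,
the simplification rule, the syntactic weakening rule, or the addition rule. -/
def InferSyn [Fintype V] [DecidableEq V] (S : Config V) (C : LinClause V) : Prop :=
  (∃ (f : LinForm V) (A B : LinClause V),
      insert (f, (0 : F2)) A ∈ S ∧ insert (f, (1 : F2)) B ∈ S ∧ C = A ∪ B) ∨
  (insert ((zeroForm V, (1 : F2)) : LinLit V) C ∈ S) ∨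
  (∃ (D : LinClause V) (f : LinForm V) (α : F2), D ∈ S ∧ C = insert (f, α) D) ∨
  (∃ (D : LinClause V) (f₁ f₂ : LinForm V) (α₁ α₂ : F2),
      insert (f₁, α₁) (insert (f₂, α₂) D) ∈ S ∧
      C = insert (f₁, α₁) (insert (f₁ + f₂, α₁ + α₂ + 1) D))

/-- One step of a configuration-style refutation: download a clause of `φ`,
erase a clause, or add a clause inferred (via `Inf`) from the current configuration. -/
inductive ConfigStep [Fintype V] [DecidableEq V] (φ : LinCNF V)
    (Inf : Config V → LinClause V → Prop) : Config V → Config V → Prop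
  | download {S : Config V} {C : LinClause V} (h : C ∈ φ) : ConfigStep φ Inf S (insert C S)
  | erase {S : Config V} {C : LinClause V} (h : C ∈ S) : ConfigStep φ Inf S (S.erase C)
  | infer {S : Config V} {C : LinClause V} (h : Inf S C) : ConfigStep φ Inf S (insert C S)

/-- A configuration-style Res(⊕) refutation of `φ` with inference rules `Inf`:
a sequence of configurations starting from the empty configuration, each obtained from
the previous one by a basic step, ending with a configuration containing the empty
clause. -/
def IsConfigRefutation [Fintype V] [DecidableEq V] (φ : LinCNF V)
    (Inf : Config V → LinClause V → Prop) (π : List (Config V)) : Prop :=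
  π.head? = some (∅ : Config V) ∧ List.Chain' (ConfigStep φ Inf) π ∧
    ∃ S : Config V, π.getLast? = some S ∧ (∅ : LinClause V) ∈ S

/-- The space of a sequence of configurations: the maximum number of clauses in memory. -/
def spaceOf (π : List (Config V)) : ℕ := (π.map Finset.card).foldr max 0

/-- The density clause `D_{ij} = ¬x_{ij} ∨ ⋁_{k ≠ i,j} z_{ikj}`. -/
def densityClause {n : ℕ} (i j : Fin n) : LinClause (DLOVar n) :=
  insert (negLit (xvar i j))
    ((Finset.univ.filter fun k : Fin n => k ≠ i ∧ k ≠ j).image fun k => posLit (zvar i k j))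

/-- The dense linear ordering principle `DLO_n` as a linear CNF. -/
def DLOCNF (n : ℕ) : LinCNF (DLOVar n) :=
  {C | ∃ i j : Fin n, i ≠ j ∧
        C = ({negLit (xvar i j), negLit (xvar j i)} : LinClause (DLOVar n))} ∪
  {C | ∃ i j : Fin n, i ≠ j ∧
        C = ({posLit (xvar i j), posLit (xvar j i)} : LinClause (DLOVar n))} ∪
  {C | ∃ i j k : Fin n, i ≠ j ∧ j ≠ k ∧ i ≠ k ∧
        C = ({negLit (xvar i j), negLit (xvar j k), posLit (xvar i k)} :
          LinClause (DLOVar n))} ∪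
  {C | ∃ i k j : Fin n, i ≠ k ∧ k ≠ j ∧ i ≠ j ∧
        C = ({negLit (zvar i k j), posLit (xvar i k)} : LinClause (DLOVar n))} ∪
  {C | ∃ i k j : Fin n, i ≠ k ∧ k ≠ j ∧ i ≠ j ∧
        C = ({negLit (zvar i k j), posLit (xvar k j)} : LinClause (DLOVar n))} ∪
  {C | ∃ i j : Fin n, i ≠ j ∧ C = densityClause i j}

section GeneralLowerBounds

variable [Fintype V]

/-- Extensibility bounds the size of any proof tree whose conclusion is falsified by all
proper solutions of a satisfiable linear system. -/
theorem Extensible.two_pow_le_size [DecidableEq V] {φ : LinCNF V} {F : Set (LinClause V)}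
    {m : ℕ} (hφ : Extensible φ F m) (T : ProofTree V) (hT : T.Valid φ) (S : LinSystem V)
    (hS : ∃ σ, SysSat σ S ∧ FProper F σ)
    (hfalse : ∀ σ, SysSat σ S → FProper F σ → ¬ ClauseSat σ T.concl) :
    2 ^ (m - S.card) ≤ T.size := by
  induction T generalizing S with
  | leaf C =>
    have hm : m ≤ S.card := by
      by_contra! hlt
      obtain ⟨σ, hσS, hσF⟩ := hS
      by_cases hCF : C ∈ F
      · exact hfalse σ hσS hσF (hσF C hCF)
      · obtain ⟨τ, hτS, hτF, hτC⟩ := hφ S hlt ⟨σ, hσS, hσF⟩ C ⟨hT, hCF⟩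
        exact hfalse τ hτS hτF hτC
    simp [ProofTree.size, Nat.sub_eq_zero_of_le hm]
  | weak C t ih =>
    have := ih hT.1 S hS fun σ h₁ h₂ h₃ => hfalse σ h₁ h₂ (hT.2 σ h₃)
    simp only [ProofTree.size]
    omega
  | res C t₁ t₂ ih₁ ih₂ =>
    obtain ⟨hv₁, hv₂, f, A, B, hA, hB, rfl⟩ := hT
    have false_left : ∀ σ, SysSat σ S → FProper F σ → evalForm f σ ≠ 0 →
        ¬ ClauseSat σ t₁.concl := by
      rintro σ hσS hσF hf ⟨l, hl, hsat⟩
      rw [hA, Finset.mem_insert] at hl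
      rcases hl with rfl | hl
      · exact hf hsat
      · exact hfalse σ hσS hσF ⟨l, Finset.mem_union_left _ hl, hsat⟩
    have false_right : ∀ σ, SysSat σ S → FProper F σ → evalForm f σ ≠ 1 →
        ¬ ClauseSat σ t₂.concl := by
      rintro σ hσS hσF hf ⟨l, hl, hsat⟩
      rw [hB, Finset.mem_insert] at hl
      rcases hl with rfl | hl
      · exact hf hsat
      · exact hfalse σ hσS hσF ⟨l, Finset.mem_union_right _ hl, hsat⟩
    have sysSat_insert : ∀ (a : F2) σ, SysSat σ (insert (f, a) S) →
        evalForm f σ = a ∧ SysSat σ S := fun a σ h =>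
      ⟨h _ (Finset.mem_insert_self _ _), fun l hl => h l (Finset.mem_insert_of_mem hl)⟩
    have insert_sat : ∀ (a : F2) σ, SysSat σ S → evalForm f σ = a →
        SysSat σ (insert (f, a) S) := by
      intro a σ h hf l hl
      rcases Finset.mem_insert.1 hl with rfl | hl
      · exact hf
      · exact h l hl
    simp only [ProofTree.size]
    by_cases h0 : ∃ σ, (SysSat σ S ∧ FProper F σ) ∧ evalForm f σ = 0
    · by_cases h1 : ∃ σ, (SysSat σ S ∧ FProper F σ) ∧ evalForm f σ = 1
      · obtain ⟨σ₀, ⟨hS₀, hF₀⟩, hf₀⟩ := h0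
        obtain ⟨σ₁, ⟨hS₁, hF₁⟩, hf₁⟩ := h1
        have b₁ := ih₁ hv₁ (insert (f, 1) S) ⟨σ₁, insert_sat 1 σ₁ hS₁ hf₁, hF₁⟩
          fun σ hσ hσF => false_left σ (sysSat_insert 1 σ hσ).2 hσF
            (by rw [(sysSat_insert 1 σ hσ).1]; decide)
        have b₂ := ih₂ hv₂ (insert (f, 0) S) ⟨σ₀, insert_sat 0 σ₀ hS₀ hf₀, hF₀⟩
          fun σ hσ hσF => false_right σ (sysSat_insert 0 σ hσ).2 hσF
            (by rw [(sysSat_insert 0 σ hσ).1]; decide)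
        have c₁ : 2 ^ (m - (S.card + 1)) ≤ 2 ^ (m - (insert (f, 1) S).card) :=
          Nat.pow_le_pow_right two_pos (Nat.sub_le_sub_left (Finset.card_insert_le _ _) m)
        have c₂ : 2 ^ (m - (S.card + 1)) ≤ 2 ^ (m - (insert (f, 0) S).card) :=
          Nat.pow_le_pow_right two_pos (Nat.sub_le_sub_left (Finset.card_insert_le _ _) m)
        have c₃ : 2 ^ (m - S.card) ≤ 2 ^ (m - (S.card + 1) + 1) :=
          Nat.pow_le_pow_right two_pos (by omega)
        rw [pow_succ] at c₃
        omega
      · have := ih₂ hv₂ S hS fun σ hσ hσF =>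
          false_right σ hσ hσF fun hf => h1 ⟨σ, ⟨hσ, hσF⟩, hf⟩
        omega
    · have := ih₁ hv₁ S hS fun σ hσ hσF =>
        false_left σ hσ hσF fun hf => h0 ⟨σ, ⟨hσ, hσF⟩, hf⟩
      omega

theorem card_le_spaceOf {V : Type} {π : List (Config V)} {S : Config V} (h : S ∈ π) :
    S.card ≤ spaceOf π := by
  induction π with
  | nil => simp at h
  | cons T π ih =>
    rcases List.mem_cons.1 h with rfl | h
    · exact le_max_left _ _
    · exact (ih h).trans (le_max_right _ _)

/-- A properly satisfiable configuration with few clauses remains so after one step. -/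
theorem ConfigStep.exists_proper [DecidableEq V] {φ : LinCNF V} {F : Set (LinClause V)}
    {m : ℕ} (hφ : Extensible φ F m) {S S' : Config V} (hstep : ConfigStep φ InferSem S S')
    (hcard : S.card < m) (hS : ∃ σ, FProper F σ ∧ ∀ C ∈ S, ClauseSat σ C) :
    ∃ σ, FProper F σ ∧ ∀ C ∈ S', ClauseSat σ C := by
  obtain ⟨σ, hσF, hσ⟩ := hS
  cases hstep with
  | @download C hC =>
    by_cases hCF : C ∈ F
    · refine ⟨σ, hσF, fun D hD => ?_⟩
      rcases Finset.mem_insert.1 hD with rfl | hD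
      · exact hσF _ hCF
      · exact hσ D hD
    · choose! l hl hsat using hσ
      obtain ⟨τ, hτ, hτF, hτC⟩ := hφ (S.image l) (Finset.card_image_le.trans_lt hcard)
        ⟨σ, fun k hk => by
          obtain ⟨D, hD, rfl⟩ := Finset.mem_image.1 hk
          exact hsat D hD, hσF⟩ C ⟨hC, hCF⟩
      refine ⟨τ, hτF, fun D hD => ?_⟩
      rcases Finset.mem_insert.1 hD with rfl | hD
      · exact hτC
      · exact ⟨l D, hl D hD, hτ _ (Finset.mem_image_of_mem l hD)⟩
  | erase _ => exact ⟨σ, hσF, fun D hD => hσ D (Finset.mem_of_mem_erase hD)⟩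
  | @infer C hC =>
    refine ⟨σ, hσF, fun D hD => ?_⟩
    rcases Finset.mem_insert.1 hD with rfl | hD
    · rcases hC with ⟨f, A, B, hA, hB, rfl⟩ | ⟨E, hE, hED⟩
      · obtain ⟨k, hk, hk'⟩ := hσ _ hA
        obtain ⟨l, hl, hl'⟩ := hσ _ hB
        rcases Finset.mem_insert.1 hk with rfl | hk
        · rcases Finset.mem_insert.1 hl with rfl | hl
          · exact absurd (hk'.symm.trans hl') zero_ne_one
          · exact ⟨l, Finset.mem_union_right _ hl, hl'⟩
        · exact ⟨k, Finset.mem_union_left _ hk, hk'⟩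
      · exact hED σ (hσ E hE)
    · exact hσ D hD

/-- Extensibility bounds the space of configuration-style refutations. -/
theorem Extensible.le_spaceOf [DecidableEq V] {φ : LinCNF V} {F : Set (LinClause V)}
    {m : ℕ} (hφ : Extensible φ F m) (hF : ∃ σ, FProper F σ) {π : List (Config V)}
    (hπ : IsConfigRefutation φ InferSem π) : m ≤ spaceOf π := by
  by_contra! hlt
  obtain ⟨hhead, hchain, S, hlast, hempty⟩ := hπ
  have key : ∀ ρ : List (Config V), (∀ T ∈ ρ, T.card < m) →
      List.IsChain (ConfigStep φ InferSem) ρ →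
      (∀ T, ρ.head? = some T → ∃ σ, FProper F σ ∧ ∀ C ∈ T, ClauseSat σ C) →
      ∀ T, ρ.getLast? = some T → ∃ σ, FProper F σ ∧ ∀ C ∈ T, ClauseSat σ C := by
    intro ρ
    induction ρ with
    | nil => simp
    | cons T ρ ih =>
      intro hc hch hh
      cases ρ with
      | nil => simpa using hh
      | cons U ρ =>
        rw [List.isChain_cons_cons] at hch
        intro W hW
        refine ih (fun R hR => hc R (List.mem_cons_of_mem _ hR)) hch.2 ?_ W
          (by simpa [List.getLast?_cons_cons] using hW)
        intro R hR
        obtain rfl : U = R := by simpa using hR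
        exact hch.1.exists_proper hφ (hc T List.mem_cons_self) (hh T rfl)
  obtain ⟨σ, -, hσ⟩ := key π (fun T hT => (card_le_spaceOf hT).trans_lt hlt) hchain
    (fun T hT => by
      obtain rfl : ∅ = T := by simpa [hhead] using hT
      obtain ⟨σ, hσ⟩ := hF
      exact ⟨σ, hσ, by simp⟩) S hlast
  obtain ⟨l, hl, -⟩ := hσ ∅ hempty
  simp at hl

end GeneralLowerBounds

section PolynomialFamilies

open MvPolynomial

/-- Any function of three affine polynomials over `F2` is a polynomial of degree at
most three. -/
theorem exists_totalDegree_le_three {ι : Type} (g : F2 → F2 → F2 → F2)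
    (p q r : MvPolynomial ι F2) (hp : p.totalDegree ≤ 1) (hq : q.totalDegree ≤ 1)
    (hr : r.totalDegree ≤ 1) :
    ∃ P : MvPolynomial ι F2, P.totalDegree ≤ 3 ∧
      ∀ y, eval y P = g (eval y p) (eval y q) (eval y r) := by
  refine ⟨∑ a : F2, ∑ b : F2, ∑ c : F2,
    C (g a b c) * ((p + C (1 + a)) * (q + C (1 + b)) * (r + C (1 + c))), ?_, ?_⟩
  · have affine : ∀ (u : MvPolynomial ι F2) (a : F2), u.totalDegree ≤ 1 →
        (u + C a).totalDegree ≤ 1 := fun u a hu =>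
      (totalDegree_add _ _).trans (max_le hu (by simp))
    refine totalDegree_finsetSum_le fun a _ => totalDegree_finsetSum_le fun b _ =>
      totalDegree_finsetSum_le fun c _ => ?_
    have h₁ := totalDegree_mul (C (g a b c))
      ((p + C (1 + a)) * (q + C (1 + b)) * (r + C (1 + c)))
    have h₂ := totalDegree_mul ((p + C (1 + a)) * (q + C (1 + b))) (r + C (1 + c))
    have h₃ := totalDegree_mul (p + C (1 + a)) (q + C (1 + b))
    have h₄ := affine p (1 + a) hp
    have h₅ := affine q (1 + b) hq
    have h₆ := affine r (1 + c) hr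
    rw [totalDegree_C] at h₁
    omega
  · intro y
    simp only [map_sum, map_mul, map_add, eval_C]
    generalize eval y p = u
    generalize eval y q = v
    generalize eval y r = w
    have huniv : (Finset.univ : Finset F2) = {0, 1} := rfl
    have h2 : (1 + 1 : F2) = 0 := rfl
    have hcases : ∀ a : F2, a = 0 ∨ a = 1 := by decide
    rcases hcases u with rfl | rfl <;> rcases hcases v with rfl | rfl <;>
      rcases hcases w with rfl | rfl <;> simp [huniv, h2]

/-- If a polynomial family of assignments of low degree contains a solution of a linear
system, then it contains the solution for another parameter (Chevalley–Warning). -/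
theorem exists_ne_zero_sysSat [Fintype V] {ι : Type} [Fintype ι] (S : LinSystem V) (d : ℕ)
    (τ : (ι → F2) → V → F2) (P : V → MvPolynomial ι F2)
    (hdeg : ∀ v, (P v).totalDegree ≤ d) (heval : ∀ v y, eval y (P v) = τ y v)
    (hcard : S.card * d < Fintype.card ι) (h0 : SysSat (τ 0) S) :
    ∃ y, y ≠ 0 ∧ SysSat (τ y) S := by
  classical
  let Q : LinLit V → MvPolynomial ι F2 := fun l => (∑ v, C (l.1 v) * P v) - C l.2
  have hQdeg : ∀ l, (Q l).totalDegree ≤ d := fun l => by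
    refine (totalDegree_sub_C_le _ _).trans (totalDegree_finsetSum_le fun v _ => ?_)
    refine (totalDegree_mul _ _).trans ?_
    simpa using hdeg v
  have hQ : ∀ y, (∀ l ∈ S, eval y (Q l) = 0) ↔ SysSat (τ y) S := fun y => by
    simp [Q, SysSat, LitSat, evalForm, heval, sub_eq_zero]
  have hsum : ∑ l ∈ S, (Q l).totalDegree < Fintype.card ι :=
    (Finset.sum_le_card_nsmul S _ d fun l _ => hQdeg l).trans_lt (by simpa using hcard)
  let z : {y : ι → F2 // ∀ l ∈ S, eval y (Q l) = 0} := ⟨0, (hQ 0).2 h0⟩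
  have hdvd : 2 ∣ Nat.card {y : ι → F2 // ∀ l ∈ S, eval y (Q l) = 0} := by
    rw [Nat.card_eq_fintype_card]
    convert char_dvd_card_solutions_of_sum_lt 2 hsum
  have hlt : 1 < Nat.card {y : ι → F2 // ∀ l ∈ S, eval y (Q l) = 0} :=
    Nat.le_of_dvd (Nat.card_pos_iff.2 ⟨⟨z⟩, inferInstance⟩) hdvd
  have := Finite.one_lt_card_iff_nontrivial.1 hlt
  obtain ⟨y, hy⟩ := exists_ne z
  exact ⟨y, fun h => hy (Subtype.ext h), (hQ y).1 y.2⟩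

end PolynomialFamilies

section DenseLinearOrder

variable {n : ℕ}

/-- The comparison of `i` with `j` once the elements marked by `y` have been moved
immediately after `s`, as a function of the marks of `i` and `j`. -/
def movedOrder (s : Fin n) (σ : DLOVar n → F2) (i j : Fin n) (a b : F2) : F2 :=
  if a = b then σ (xvar i j)
  else if a = 1 then (if j = s then 0 else σ (xvar s j))
  else (if i = s then 1 else σ (xvar i s))

/-- The witness variables after the marked elements have been moved, as a function of
the three marks: `z_{skt}` is set for all marked `k`. -/
def movedWitness (s t : Fin n) (σ : DLOVar n → F2) (i k j : Fin n) (a b c : F2) : F2 :=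
  if a = b ∧ b = c then σ (zvar i k j)
  else if i = s ∧ j = t ∧ b = 1 then 1 else 0

/-- The assignment obtained from `σ` by moving the elements marked by `w` immediately
after `s`. -/
def moveAfter (s t : Fin n) (σ : DLOVar n → F2) (w : Fin n → F2) : DLOVar n → F2
  | Sum.inl (i, j) => movedOrder s σ i j (w i) (w j)
  | Sum.inr (i, k, j) => movedWitness s t σ i k j (w i) (w k) (w j)

theorem moveAfter_zero (s t : Fin n) (σ : DLOVar n → F2) : moveAfter s t σ 0 = σ := by
  funext v
  rcases v with ⟨i, j⟩ | ⟨i, k, j⟩ <;>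
    simp [moveAfter, movedOrder, movedWitness, xvar, zvar]

theorem moveAfter_wOrderProper {s t : Fin n} (hst : s ≠ t) {σ : DLOVar n → F2}
    (hσ : WOrderProper σ) (hx : σ (xvar s t) = 1) {w : Fin n → F2} (hs : w s = 0)
    (ht : w t = 0) : WOrderProper (moveAfter s t σ w) := by
  obtain ⟨antisymm, total, trans, wit⟩ := hσ
  have hcases : ∀ a : F2, a = 0 ∨ a = 1 := by decide
  have h01 : (0 : F2) ≠ 1 := by decide
  refine ⟨fun i j hij => ?_, fun i j hij => ?_, fun i j k hij hjk hik => ?_,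
    fun i k j hik hkj hij => ?_⟩
  · simp only [moveAfter, movedOrder, xvar] at *
    rcases hcases (w i) with hi | hi <;> rcases hcases (w j) with hj | hj <;> grind
  · simp only [moveAfter, movedOrder, xvar] at *
    rcases hcases (w i) with hi | hi <;> rcases hcases (w j) with hj | hj <;> grind
  · simp only [moveAfter, movedOrder, xvar] at *
    rcases hcases (w i) with hi | hi <;> rcases hcases (w j) with hj | hj <;>
      rcases hcases (w k) with hk | hk <;> grind
  · simp only [moveAfter, movedOrder, movedWitness, xvar, zvar] at *
    grind

theorem moveAfter_densitySat {s t : Fin n} (σ : DLOVar n → F2) {w : Fin n → F2}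
    (hs : w s = 0) (ht : w t = 0) {k : Fin n} (hk : w k = 1) :
    DensitySat s t (moveAfter s t σ w) := by
  have h01 : (0 : F2) ≠ 1 := by decide
  refine Or.inr ⟨k, ?_, ?_, ?_⟩
  · rintro rfl
    exact h01 (hs.symm.trans hk)
  · rintro rfl
    exact h01 (ht.symm.trans hk)
  · simp [moveAfter, movedWitness, zvar, hs, ht, hk]

/-- A small linear system with a proper solution has a proper solution satisfying any
given density clause. -/
theorem exists_wOrderProper_densitySat {S : LinSystem (DLOVar n)} {σ : DLOVar n → F2}
    (hcard : S.card * 3 < n - 2) (hS : SysSat σ S) (hσ : WOrderProper σ) {s t : Fin n}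
    (hst : s ≠ t) : ∃ τ, SysSat τ S ∧ WOrderProper τ ∧ DensitySat s t τ := by
  have hcases : ∀ a : F2, a = 0 ∨ a = 1 := by decide
  rcases hcases (σ (xvar s t)) with hx | hx
  · exact ⟨σ, hS, hσ, Or.inl hx⟩
  let ι := {k : Fin n // k ∈ ({s, t} : Finset (Fin n))ᶜ}
  let mark : (ι → F2) → Fin n → F2 := fun y k =>
    if h : k ∈ ({s, t} : Finset (Fin n))ᶜ then y ⟨k, h⟩ else 0
  let X : Fin n → MvPolynomial ι F2 := fun k =>
    if h : k ∈ ({s, t} : Finset (Fin n))ᶜ then MvPolynomial.X ⟨k, h⟩ else 0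
  have hXdeg : ∀ k, (X k).totalDegree ≤ 1 := fun k => by
    by_cases h : k ∈ ({s, t} : Finset (Fin n))ᶜ
    · simp only [X, dif_pos h, MvPolynomial.totalDegree_X, le_refl]
    · simp only [X, dif_neg h, MvPolynomial.totalDegree_zero, zero_le]
  have hXeval : ∀ y k, MvPolynomial.eval y (X k) = mark y k := fun y k => by
    by_cases h : k ∈ ({s, t} : Finset (Fin n))ᶜ
    · simp only [X, mark, dif_pos h, MvPolynomial.eval_X]
    · simp only [X, mark, dif_neg h, map_zero]
  have hP : ∀ v, ∃ P : MvPolynomial ι F2, P.totalDegree ≤ 3 ∧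
      ∀ y, MvPolynomial.eval y P = moveAfter s t σ (mark y) v := by
    rintro (⟨i, j⟩ | ⟨i, k, j⟩)
    · simpa only [hXeval, moveAfter] using exists_totalDegree_le_three
        (fun a b _ => movedOrder s σ i j a b) (X i) (X j) 0 (hXdeg i) (hXdeg j) (by simp)
    · simpa only [hXeval, moveAfter] using exists_totalDegree_le_three
        (movedWitness s t σ i k j) (X i) (X k) (X j) (hXdeg i) (hXdeg k) (hXdeg j)
  choose P hPdeg hPeval using hP
  have hmark0 : mark 0 = 0 := by
    funext k
    simp [mark]
  have hs : ∀ y, mark y s = 0 := fun y => by simp [mark]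
  have ht : ∀ y, mark y t = 0 := fun y => by simp [mark]
  have hι : Fintype.card ι = n - 2 := by
    rw [Fintype.card_coe, Finset.card_compl, Finset.card_pair hst, Fintype.card_fin]
  obtain ⟨y, hy, hyS⟩ := exists_ne_zero_sysSat S 3 (fun y => moveAfter s t σ (mark y)) P
    hPdeg hPeval (hι ▸ hcard) (by simpa only [hmark0, moveAfter_zero] using hS)
  obtain ⟨k, hk⟩ := Function.ne_iff.1 hy
  have hk1 : mark y k = 1 := by
    simp only [mark, dif_pos k.2]
    exact (hcases (y k)).resolve_left hk
  exact ⟨_, hyS, moveAfter_wOrderProper hst hσ hx (hs y) (ht y),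
    moveAfter_densitySat σ (hs y) (ht y) hk1⟩

theorem evalForm_single [Fintype V] [DecidableEq V] (v : V) (σ : V → F2) :
    evalForm (Pi.single v 1) σ = σ v := by
  simp [evalForm, Pi.single_apply]

theorem litSat_posLit [Fintype V] [DecidableEq V] (v : V) (σ : V → F2) :
    LitSat σ (posLit v) ↔ σ v = 1 := by
  simp [LitSat, posLit, evalForm_single]

theorem litSat_negLit [Fintype V] [DecidableEq V] (v : V) (σ : V → F2) :
    LitSat σ (negLit v) ↔ σ v = 0 := by
  simp [LitSat, negLit, evalForm_single]

theorem clauseSat_densityClause (σ : DLOVar n → F2) (s t : Fin n) :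
    ClauseSat σ (densityClause s t) ↔ DensitySat s t σ := by
  simp [ClauseSat, densityClause, DensitySat, litSat_posLit, litSat_negLit, and_assoc]

/-- The clauses of `DLO_n` other than the density clauses. -/
def worderClauses (n : ℕ) : LinCNF (DLOVar n) :=
  {C | ∃ i j : Fin n, i ≠ j ∧
        C = ({negLit (xvar i j), negLit (xvar j i)} : LinClause (DLOVar n))} ∪
  {C | ∃ i j : Fin n, i ≠ j ∧
        C = ({posLit (xvar i j), posLit (xvar j i)} : LinClause (DLOVar n))} ∪
  {C | ∃ i j k : Fin n, i ≠ j ∧ j ≠ k ∧ i ≠ k ∧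
        C = ({negLit (xvar i j), negLit (xvar j k), posLit (xvar i k)} :
          LinClause (DLOVar n))} ∪
  {C | ∃ i k j : Fin n, i ≠ k ∧ k ≠ j ∧ i ≠ j ∧
        C = ({negLit (zvar i k j), posLit (xvar i k)} : LinClause (DLOVar n))} ∪
  {C | ∃ i k j : Fin n, i ≠ k ∧ k ≠ j ∧ i ≠ j ∧
        C = ({negLit (zvar i k j), posLit (xvar k j)} : LinClause (DLOVar n))}

theorem fProper_worderClauses (σ : DLOVar n → F2) :
    FProper (worderClauses n) σ ↔ WOrderProper σ := by
  have eq_zero_iff : ∀ a : F2, a = 0 ↔ a ≠ 1 := by decide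
  constructor
  · intro h
    refine ⟨fun i j hij => ?_, fun i j hij => ?_, fun i j k hij hjk hik => ?_,
      fun i k j hik hkj hij => ?_⟩
    · have := h _ (.inl (.inl (.inl (.inl ⟨i, j, hij, rfl⟩))))
      simp only [ClauseSat, Finset.exists_mem_insert, Finset.mem_singleton, exists_eq_left,
        litSat_negLit, eq_zero_iff] at this
      tauto
    · have := h _ (.inl (.inl (.inl (.inr ⟨i, j, hij, rfl⟩))))
      simpa only [ClauseSat, Finset.exists_mem_insert, Finset.mem_singleton, exists_eq_left,
        litSat_posLit] using this
    · have := h _ (.inl (.inl (.inr ⟨i, j, k, hij, hjk, hik, rfl⟩)))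
      simp only [ClauseSat, Finset.exists_mem_insert, Finset.mem_singleton, exists_eq_left,
        litSat_posLit, litSat_negLit, eq_zero_iff] at this
      tauto
    · have h₁ := h _ (.inl (.inr ⟨i, k, j, hik, hkj, hij, rfl⟩))
      have h₂ := h _ (.inr ⟨i, k, j, hik, hkj, hij, rfl⟩)
      simp only [ClauseSat, Finset.exists_mem_insert, Finset.mem_singleton, exists_eq_left,
        litSat_posLit, litSat_negLit, eq_zero_iff] at h₁ h₂
      tauto
  · rintro ⟨antisymm, total, trans, wit⟩ C
      ((((⟨i, j, hij, rfl⟩ | ⟨i, j, hij, rfl⟩) | ⟨i, j, k, hij, hjk, hik, rfl⟩) |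
        ⟨i, k, j, hik, hkj, hij, rfl⟩) | ⟨i, k, j, hik, hkj, hij, rfl⟩) <;>
      simp only [ClauseSat, Finset.exists_mem_insert, Finset.mem_singleton, exists_eq_left,
        litSat_posLit, litSat_negLit, eq_zero_iff]
    · have := antisymm i j hij
      tauto
    · exact total i j hij
    · have := trans i j k hij hjk hik
      tauto
    · have := wit i k j hik hkj hij
      tauto
    · have := wit i k j hik hkj hij
      tauto

/-- The natural order without witnesses is proper. -/
theorem exists_wOrderProper (n : ℕ) : ∃ σ : DLOVar n → F2, WOrderProper σ := by
  refine ⟨Sum.elim (fun p => if p.1 < p.2 then 1 else 0) 0, ?_, ?_, ?_, ?_⟩ <;>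
    simp only [xvar, zvar, Sum.elim_inl, Sum.elim_inr, Pi.zero_apply, ite_eq_left_iff,
      zero_ne_one, imp_false, not_not]
  · exact fun i j _ h => lt_asymm h.1 h.2
  · exact fun i j hij => lt_or_gt_of_ne hij
  · exact fun i j k _ _ _ => lt_trans
  · exact fun _ _ _ _ _ _ h => h.elim

theorem extensible_dloCNF (hn : 3 ≤ n) :
    Extensible (DLOCNF n) (worderClauses n) ((n - 3) / 3 + 1) := by
  rintro S hS ⟨σ, hσS, hσ⟩ C ⟨hC | ⟨s, t, hst, rfl⟩, hCF⟩
  · exact absurd hC hCF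
  · obtain ⟨τ, hτS, hτ, hτst⟩ := exists_wOrderProper_densitySat (by omega) hσS
      ((fProper_worderClauses σ).1 hσ) hst
    exact ⟨τ, hτS, (fProper_worderClauses τ).2 hτ, (clauseSat_densityClause τ s t).2 hτst⟩

end DenseLinearOrder

/-- For `n ≥ 3`: every tree-like Res(⊕) refutation of `DLO_n` has size at
least `2^⌊(n-3)/3⌋`, and every configuration-style Res(⊕) refutation of `DLO_n` has space
at least `⌊(n-3)/3⌋`. -/
theorem dlo_size_and_space_lower_bounds (n : ℕ) (hn : 3 ≤ n) :
    (∀ T : ProofTree (DLOVar n),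
        IsTreeRefutation (DLOCNF n) T → 2 ^ ((n - 3) / 3) ≤ T.size) ∧
    (∀ π : List (Config (DLOVar n)),
        IsConfigRefutation (DLOCNF n) InferSem π → (n - 3) / 3 ≤ spaceOf π) := by
  obtain ⟨σ, hσ⟩ := exists_wOrderProper n
  have hproper := (fProper_worderClauses σ).2 hσ
  refine ⟨fun T hT => ?_, fun π hπ => ?_⟩
  · have hsize := (extensible_dloCNF hn).two_pow_le_size T hT.1 ∅
      ⟨σ, by simp [SysSat], hproper⟩ fun τ _ _ => by simp [hT.2, ClauseSat]
    exact (Nat.pow_le_pow_right two_pos (by simp)).trans hsize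
  · exact (Nat.le_succ _).trans ((extensible_dloCNF hn).le_spaceOf ⟨σ, hproper⟩ hπ)
end
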